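/- arXiv:2407.13367 — 7 statements merged into one kernel-verified Lean document; each statement's English description precedes it below -/
import Mathlib

section
/- Let C and D be two nonempty, closed, convex subsets of a real Hilbert space H, let x₀ ∈ H, and set ρ = ‖x₀‖ + d(x₀, C) + d(x₀, D). Then ‖P_C(x₀) − P_D(x₀)‖ ≤ √(ρ · d_{H,ρ}(C, D)), where d_{H,ρ}(C, D) = max{sup_{u ∈ C ∩ ρB} d(u, D), sup_{v ∈ D ∩ ρB} d(v, C)} and B is the closed unit ball of H. -/
/-- The distance from `z` to its projection is `infDist z K`. -/
lemma aux_norm_eq_infDist {H : Type*} [NormedAddCommGroup H] {K : Set H} {z p : H} (hp : p ∈ K)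
    (h : ∀ u ∈ K, ‖z - p‖ ≤ ‖z - u‖) : ‖z - p‖ = Metric.infDist z K := by
  apply le_antisymm
  · rw [Metric.le_infDist ⟨p, hp⟩]
    intro y hy
    rw [dist_eq_norm]
    exact h y hy
  · rw [← dist_eq_norm]
    exact Metric.infDist_le_dist_of_mem hp

/-- Variational characterization of the projection. -/
lemma aux_inner_le_zero {H : Type*} [NormedAddCommGroup H] [InnerProductSpace ℝ H]
    {K : Set H} (hK : Convex ℝ K) {z p : H} (hp : p ∈ K)
    (h : ∀ u ∈ K, ‖z - p‖ ≤ ‖z - u‖) : ∀ w ∈ K, inner ℝ (z - p) (w - p) ≤ 0 := by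
  rw [← norm_eq_iInf_iff_real_inner_le_zero hK hp]
  haveI : Nonempty K := ⟨⟨p, hp⟩⟩
  apply le_antisymm
  · exact le_ciInf fun w => h w w.2
  · exact ciInf_le (f := fun w : K => ‖z - w‖)
      ⟨0, by rintro _ ⟨w, rfl⟩; exact norm_nonneg _⟩ ⟨p, hp⟩

/-- The distance to `D` is bounded on bounded sets, so the supremum is an upper bound. -/
lemma aux_le_sSup {H : Type*} [NormedAddCommGroup H] {C D : Set H} (hD : D.Nonempty) {ρ : ℝ}
    {p : H} (hp : p ∈ C) (hpρ : ‖p‖ ≤ ρ) :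
    Metric.infDist p D ≤ sSup ((fun u => Metric.infDist u D) '' (C ∩ Metric.closedBall 0 ρ)) := by
  obtain ⟨d, hd⟩ := hD
  apply le_csSup
  · refine ⟨ρ + ‖d‖, ?_⟩
    rintro _ ⟨u, ⟨_, hu⟩, rfl⟩
    rw [mem_closedBall_zero_iff] at hu
    have h1 : Metric.infDist u D ≤ dist u d := Metric.infDist_le_dist_of_mem hd
    rw [dist_eq_norm] at h1
    have h2 := norm_sub_le u d
    show Metric.infDist u D ≤ _
    linarith
  · exact ⟨p, ⟨hp, by rwa [mem_closedBall_zero_iff]⟩, rfl⟩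

/-- One half of the estimate. -/
lemma aux_half {H : Type*} [NormedAddCommGroup H] [InnerProductSpace ℝ H]
    {D : Set H} (hD : Convex ℝ D) {x q p p' : H} (hq : q ∈ D)
    (h : ∀ u ∈ D, ‖x - q‖ ≤ ‖x - u‖) (hp' : p' ∈ D) (h' : ∀ u ∈ D, ‖p - p'‖ ≤ ‖p - u‖) :
    inner ℝ (x - q) (p - q) ≤ Metric.infDist x D * Metric.infDist p D := by
  rw [← aux_norm_eq_infDist hq h, ← aux_norm_eq_infDist hp' h']
  have h1 := aux_inner_le_zero hD hq h p' hp'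
  have h2 := real_inner_le_norm (x - q) (p - p')
  have h3 : inner ℝ (x - q) (p - q) = inner ℝ (x - q) (p - p') + inner ℝ (x - q) (p' - q) := by
    rw [← inner_add_right, sub_add_sub_cancel]
  linarith

/-- Attouch–Wets estimate: for nonempty, closed, convex `C, D ⊆ H`,
`x₀ ∈ H` and `ρ = ‖x₀‖ + d(x₀,C) + d(x₀,D)`, one has
`‖P_C(x₀) − P_D(x₀)‖ ≤ √(ρ · d_{H,ρ}(C,D))`, where `d_{H,ρ}` is the truncated Hausdorff
distance `max{sup_{u ∈ C ∩ ρB} d(u,D), sup_{v ∈ D ∩ ρB} d(v,C)}` and `B` is the closed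
unit ball. -/
theorem norm_proj_sub_proj_le_sqrt_truncated_hausdorff
    {H : Type*} [NormedAddCommGroup H] [InnerProductSpace ℝ H] [CompleteSpace H]
    (C D : Set H)
    (hCne : C.Nonempty) (hCcl : IsClosed C) (hCcv : Convex ℝ C)
    (hDne : D.Nonempty) (hDcl : IsClosed D) (hDcv : Convex ℝ D)
    (PC PD : H → H)
    (hPC : ∀ z : H, PC z ∈ C ∧ ∀ u ∈ C, ‖z - PC z‖ ≤ ‖z - u‖)
    (hPD : ∀ z : H, PD z ∈ D ∧ ∀ u ∈ D, ‖z - PD z‖ ≤ ‖z - u‖)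
    (x₀ : H) (ρ : ℝ)
    (hρ : ρ = ‖x₀‖ + Metric.infDist x₀ C + Metric.infDist x₀ D) :
    ‖PC x₀ - PD x₀‖ ≤ Real.sqrt (ρ *
      max (sSup ((fun u => Metric.infDist u D) '' (C ∩ Metric.closedBall 0 ρ)))
          (sSup ((fun v => Metric.infDist v C) '' (D ∩ Metric.closedBall 0 ρ)))) := by
  obtain ⟨hp, hp2⟩ := hPC x₀
  obtain ⟨hq, hq2⟩ := hPD x₀
  set p := PC x₀
  set q := PD x₀
  have a1 := aux_half hDcv hq hq2 (hPD p).1 (hPD p).2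
  have a2 := aux_half hCcv hp hp2 (hPC q).1 (hPC q).2
  have nC := aux_norm_eq_infDist hp hp2
  have nD := aux_norm_eq_infDist hq hq2
  have dC : 0 ≤ Metric.infDist x₀ C := Metric.infDist_nonneg
  have dD : 0 ≤ Metric.infDist x₀ D := Metric.infDist_nonneg
  have bp : ‖p‖ ≤ ρ := by
    have := norm_sub_le x₀ (x₀ - p)
    rw [sub_sub_cancel] at this
    linarith
  have bq : ‖q‖ ≤ ρ := by
    have := norm_sub_le x₀ (x₀ - q)
    rw [sub_sub_cancel] at this
    linarith
  have s1 := (aux_le_sSup hDne hp bp).trans (le_max_left _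
    (sSup ((fun v => Metric.infDist v C) '' (D ∩ Metric.closedBall 0 ρ))))
  have s2 := (aux_le_sSup hCne hq bq).trans (le_max_right
    (sSup ((fun u => Metric.infDist u D) '' (C ∩ Metric.closedBall 0 ρ))) _)
  set h := max (sSup ((fun u => Metric.infDist u D) '' (C ∩ Metric.closedBall 0 ρ)))
    (sSup ((fun v => Metric.infDist v C) '' (D ∩ Metric.closedBall 0 ρ)))
  have h0 : 0 ≤ h := Metric.infDist_nonneg.trans s1
  apply Real.le_sqrt_of_sq_le
  have key : ‖p - q‖ ^ 2 = inner ℝ (x₀ - q) (p - q) + inner ℝ (x₀ - p) (q - p) := by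
    rw [← real_inner_self_eq_norm_sq, ← neg_sub p q, inner_neg_right, ← sub_eq_add_neg,
      ← inner_sub_left, sub_sub_sub_cancel_left]
  have m1 := mul_le_mul_of_nonneg_left s1 dD
  have m2 := mul_le_mul_of_nonneg_left s2 dC
  have m3 := mul_nonneg (norm_nonneg x₀) h0
  rw [key, hρ, add_mul, add_mul]
  linarith
end

section
/- Let H be a real Hilbert space and let T : H → H be μ-strongly monotone and L-Lipschitz continuous with L ≥ μ > 0, and let ξ > 0. Then the reflected resolvent R_{ξT} = 2(I + ξT)^{-1} − I is Lipschitz continuous with modulus L_{ξT} := √(1 − 4ξμ/(1 + 2ξμ + ξ²L²)); that is, if p + ξT(p) = u and q + ξT(q) = v, then ‖(2p − u) − (2q − v)‖ ≤ L_{ξT} ‖u − v‖. -/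
open scoped RealInnerProductSpace

/-- Giselsson: If `T : H → H` is `μ`-strongly monotone and `L`-Lipschitz
with `L ≥ μ > 0` and `ξ > 0`, then the reflected resolvent `R_{ξT} = 2(I + ξT)⁻¹ − I` is
Lipschitz with modulus `L_{ξT} = √(1 − 4ξμ/(1 + 2ξμ + ξ²L²))`: if `p + ξT(p) = u` and
`q + ξT(q) = v`, then `‖(2p − u) − (2q − v)‖ ≤ L_{ξT}‖u − v‖`. -/
theorem reflected_resolvent_lipschitz
    {H : Type*} [NormedAddCommGroup H] [InnerProductSpace ℝ H]
    (T : H → H) (μ L : ℝ) (hμ : 0 < μ) (hLμ : μ ≤ L)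
    (hmono : ∀ x y : H, μ * ‖x - y‖ ^ 2 ≤ ⟪T x - T y, x - y⟫)
    (hLip : ∀ x y : H, ‖T x - T y‖ ≤ L * ‖x - y‖)
    (ξ : ℝ) (hξ : 0 < ξ)
    (p q u v : H) (hp : p + ξ • T p = u) (hq : q + ξ • T q = v) :
    ‖((2 : ℝ) • p - u) - ((2 : ℝ) • q - v)‖ ≤
      Real.sqrt (1 - 4 * ξ * μ / (1 + 2 * ξ * μ + ξ ^ 2 * L ^ 2)) * ‖u - v‖ := by
  have hD : 0 < 1 + 2 * ξ * μ + ξ ^ 2 * L ^ 2 := by positivity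
  have hLL : μ ^ 2 ≤ L ^ 2 := by gcongr
  have h0 : 0 ≤ 1 - 4 * ξ * μ / (1 + 2 * ξ * μ + ξ ^ 2 * L ^ 2) := by
    rw [sub_nonneg, div_le_one hD]
    nlinarith [sq_nonneg (1 - ξ * μ), mul_le_mul_of_nonneg_left hLL (sq_nonneg ξ)]
  have e1 : ((2 : ℝ) • p - u) - ((2 : ℝ) • q - v) = (p - q) - ξ • (T p - T q) := by
    rw [← hp, ← hq]; module
  have e2 : u - v = (p - q) + ξ • (T p - T q) := by
    rw [← hp, ← hq]; module
  have hm := hmono p q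
  have hl : ‖T p - T q‖ ^ 2 ≤ L ^ 2 * ‖p - q‖ ^ 2 := by
    rw [← mul_pow]
    exact pow_le_pow_left₀ (norm_nonneg _) (hLip p q) 2
  rw [e1, e2]
  generalize T p - T q = t at *
  generalize p - q = d at *
  have n1 : ‖d - ξ • t‖ ^ 2 = ‖d‖ ^ 2 - 2 * ξ * ⟪t, d⟫ + ξ ^ 2 * ‖t‖ ^ 2 := by
    rw [norm_sub_sq_real, inner_smul_right, norm_smul, mul_pow, Real.norm_eq_abs, sq_abs,
      real_inner_comm]
    ring
  have n2 : ‖d + ξ • t‖ ^ 2 = ‖d‖ ^ 2 + 2 * ξ * ⟪t, d⟫ + ξ ^ 2 * ‖t‖ ^ 2 := by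
    rw [norm_add_sq_real, inner_smul_right, norm_smul, mul_pow, Real.norm_eq_abs, sq_abs,
      real_inner_comm]
    ring
  refine (sq_le_sq₀ (norm_nonneg _) (by positivity)).1 ?_
  rw [mul_pow, Real.sq_sqrt h0, n1, n2]
  generalize ‖d‖ ^ 2 = a at *
  generalize ‖t‖ ^ 2 = c at *
  generalize (⟪t, d⟫ : ℝ) = b at *
  have key : 4 * ξ * μ / (1 + 2 * ξ * μ + ξ ^ 2 * L ^ 2) * (a + 2 * ξ * b + ξ ^ 2 * c)
      ≤ 4 * ξ * b := by
    rw [div_mul_eq_mul_div, div_le_iff₀ hD]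
    have k1 : 0 ≤ 4 * ξ * (1 + ξ ^ 2 * L ^ 2) * (b - μ * a) :=
      mul_nonneg (by positivity) (sub_nonneg.2 hm)
    have k2 : 0 ≤ 4 * ξ * μ * ξ ^ 2 * (L ^ 2 * a - c) :=
      mul_nonneg (by positivity) (sub_nonneg.2 hl)
    linarith
  linarith
end

section
/- Let L ≥ μ > 0 and set γ = L/μ ≥ 1. For ξ > 0 define L_{ξ} := √(1 − 4ξμ/(1 + 2ξμ + ξ²L²)). Then ξ* = 1/L minimizes L_{ξ} over ξ > 0, and L_{ξ*} = √((γ − 1)/(γ + 1)); that is, √((γ − 1)/(γ + 1)) ≤ L_{ξ} for every ξ > 0, with equality at ξ = 1/L. -/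
/-- For `L ≥ μ > 0`, `γ = L/μ`, and
`L_ξ = √(1 − 4ξμ/(1 + 2ξμ + ξ²L²))` for `ξ > 0`, the value `ξ* = 1/L` minimizes `L_ξ`
over `ξ > 0`, with minimal value `√((γ − 1)/(γ + 1))`. -/
theorem optimal_resolvent_modulus (L μ : ℝ) (hμ : 0 < μ) (hLμ : μ ≤ L) (γ : ℝ)
    (hγ : γ = L / μ) :
    (∀ ξ : ℝ, 0 < ξ →
      Real.sqrt ((γ - 1) / (γ + 1)) ≤
        Real.sqrt (1 - 4 * ξ * μ / (1 + 2 * ξ * μ + ξ ^ 2 * L ^ 2))) ∧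
    Real.sqrt (1 - 4 * (1 / L) * μ / (1 + 2 * (1 / L) * μ + (1 / L) ^ 2 * L ^ 2)) =
      Real.sqrt ((γ - 1) / (γ + 1)) := by
  have hL : 0 < L := lt_of_lt_of_le hμ hLμ
  have key : (γ - 1) / (γ + 1) = 1 - 2 * μ / (L + μ) := by
    subst hγ
    have h1 : L / μ + 1 ≠ 0 := by positivity
    have h2 : L + μ ≠ 0 := by positivity
    field_simp
    ring
  rw [key]
  constructor
  · intro ξ hξ
    apply Real.sqrt_le_sqrt
    apply sub_le_sub_left
    rw [div_le_div_iff₀ (by positivity) (by positivity)]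
    nlinarith [mul_nonneg hμ.le (sq_nonneg (1 - ξ * L))]
  · congr 2
    have e : (1 / L) ^ 2 * L ^ 2 = 1 := by field_simp
    rw [e, div_eq_div_iff (by positivity) (by positivity)]
    field_simp
    ring
end

section
/- Let H be a real Hilbert space, C ⊆ H a nonempty, closed, convex set, Φ : C ⇉ H a set-valued map with Φ(x) nonempty, closed, and convex for every x ∈ C, T : H → H μ-strongly monotone and L-Lipschitz continuous with μ > 0, and ξ > 0. Suppose (z*, y*, x*) ∈ H × H × C satisfies z* = P_{Φ(x*)}(y*), y* = R_{ξT}(2z* − y*), and x* = P_C(z*). Then x* is a projected solution of the quasi-variational inequality: x* = P_C(z*), z* ∈ Φ(x*), and ⟨T(z*), v − z*⟩ ≥ 0 for all v ∈ Φ(x*). -/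
open scoped RealInnerProductSpace

/-- Proposition: sufficiency of the fixed-point system: If
`(z*, y*, x*) ∈ H × H × C` satisfies `z* = P_{Φ(x*)}(y*)`, `y* = R_{ξT}(2z* − y*)` and
`x* = P_C(z*)`, then `x*` is a projected solution of the quasi-variational inequality:
`x* = P_C(z*)`, `z* ∈ Φ(x*)` and `⟨T(z*), v − z*⟩ ≥ 0` for all `v ∈ Φ(x*)`. -/
theorem projected_solution_of_fixed_point
    {H : Type*} [NormedAddCommGroup H] [InnerProductSpace ℝ H]
    (C : Set H) (hCne : C.Nonempty) (hCcl : IsClosed C) (hCcv : Convex ℝ C)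
    (Φ : H → Set H)
    (hΦ : ∀ x ∈ C, (Φ x).Nonempty ∧ IsClosed (Φ x) ∧ Convex ℝ (Φ x))
    (T : H → H) (μ L : ℝ) (hμ : 0 < μ)
    (hmono : ∀ x y : H, μ * ‖x - y‖ ^ 2 ≤ ⟪T x - T y, x - y⟫)
    (hLip : ∀ x y : H, ‖T x - T y‖ ≤ L * ‖x - y‖)
    (ξ : ℝ) (hξ : 0 < ξ)
    (J : H → H) (hJ : ∀ u : H, J u + ξ • T (J u) = u)
    (PC : H → H) (hPC : ∀ z : H, PC z ∈ C ∧ ∀ u ∈ C, ‖z - PC z‖ ≤ ‖z - u‖)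
    (PΦ : H → H → H)
    (hPΦ : ∀ x ∈ C, ∀ z : H, PΦ x z ∈ Φ x ∧ ∀ u ∈ Φ x, ‖z - PΦ x z‖ ≤ ‖z - u‖)
    (zs ys xs : H) (hxs : xs ∈ C)
    (h1 : zs = PΦ xs ys)
    (h2 : ys = (2 : ℝ) • J ((2 : ℝ) • zs - ys) - ((2 : ℝ) • zs - ys))
    (h3 : xs = PC zs) :
    xs = PC zs ∧ zs ∈ Φ xs ∧ ∀ v ∈ Φ xs, 0 ≤ ⟪T zs, v - zs⟫ := by
  obtain ⟨hmem, hmin⟩ := hPΦ xs hxs ys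
  rw [← h1] at hmem hmin
  refine ⟨h3, hmem, fun v hv => ?_⟩
  have hJz : J ((2 : ℝ) • zs - ys) = zs := by
    have h : (2 : ℝ) • J ((2 : ℝ) • zs - ys) = (2 : ℝ) • zs := by
      have h4 := eq_sub_iff_add_eq.mp h2
      rw [← h4]; abel
    exact smul_right_injective H (two_ne_zero : (2 : ℝ) ≠ 0) h
  have hT : ξ • T zs = -(ys - zs) := by
    have h := hJ ((2 : ℝ) • zs - ys)
    rw [hJz, two_smul] at h
    rw [eq_sub_of_add_eq' h]; abel
  have hinf : ‖ys - zs‖ = ⨅ w : Φ xs, ‖ys - w‖ := by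
    haveI : Nonempty (Φ xs) := ⟨⟨zs, hmem⟩⟩
    apply le_antisymm
    · exact le_ciInf fun w => hmin w w.2
    · exact ciInf_le ⟨0, by rintro _ ⟨w, rfl⟩; exact norm_nonneg _⟩ (⟨zs, hmem⟩ : Φ xs)
  have hin := (norm_eq_iInf_iff_real_inner_le_zero (hΦ xs hxs).2.2 hmem).mp hinf v hv
  have h5 : ξ * ⟪T zs, v - zs⟫ = -⟪ys - zs, v - zs⟫ := by
    rw [← real_inner_smul_left, hT, inner_neg_left]
  have h6 : 0 ≤ ξ * ⟪T zs, v - zs⟫ := by rw [h5]; linarith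
  exact nonneg_of_mul_nonneg_right h6 hξ
end

section
/- Let H be a real Hilbert space, C ⊆ H nonempty, closed, convex; Φ : C ⇉ H with Φ(x) nonempty, closed, convex for every x ∈ C and ‖P_{Φ(x)}(z) − P_{Φ(y)}(z)‖ ≤ l‖x − y‖ for all x, y ∈ C, z ∈ H; and T : H → H μ-strongly monotone and L-Lipschitz with 1 ≤ γ := L/μ < 5/3. Set ξ = 1/L and L_{ξT} = √((γ − 1)/(γ + 1)), and suppose α, β > 0 satisfy 2l ≤ β ≤ α L_{ξT} and α + 2L_{ξT} < 1. Define ρ : H × H × C → H × H × C by ρ(z, y, x) = (P_{Φ(x)}(y), R_{ξT}(2P_{Φ(x)}(y) − y), P_C(z)) and ‖(z, y, x)‖₁ = α‖z‖ + ‖y‖ + β‖x‖. Then ρ is δ-contractive with δ = α + 2L_{ξT} < 1: for all w₁ = (z₁, y₁, x₁) and w₂ = (z₂, y₂, x₂) in H × H × C, ‖ρ(w₁) − ρ(w₂)‖₁ ≤ δ‖w₁ − w₂‖₁. -/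
open scoped RealInnerProductSpace

lemma le_of_sq_le_sq_aux {a b : ℝ} (h : a ^ 2 ≤ b ^ 2) (hb : 0 ≤ b) : a ≤ b := by
  nlinarith [abs_le_of_sq_le_sq h hb, le_abs_self a]

lemma proj_var {H : Type*} [NormedAddCommGroup H] [InnerProductSpace ℝ H]
    {K : Set H} (hK : Convex ℝ K) {a p : H} (hp : p ∈ K)
    (h : ∀ u ∈ K, ‖a - p‖ ≤ ‖a - u‖) {w : H} (hw : w ∈ K) : ⟪a - p, w - p⟫ ≤ 0 := by
  have heq : ‖a - p‖ = ⨅ w : K, ‖a - w‖ := by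
    haveI : Nonempty K := ⟨⟨p, hp⟩⟩
    apply le_antisymm
    · exact le_ciInf fun u => h u u.2
    · exact ciInf_le (f := fun w : K => ‖a - w‖)
        ⟨0, by rintro _ ⟨u, rfl⟩; exact norm_nonneg _⟩ ⟨p, hp⟩
  exact (norm_eq_iInf_iff_real_inner_le_zero hK hp).1 heq w hw

lemma proj_firm {H : Type*} [NormedAddCommGroup H] [InnerProductSpace ℝ H]
    {K : Set H} (hK : Convex ℝ K) (P : H → H)
    (hP : ∀ z, P z ∈ K ∧ ∀ u ∈ K, ‖z - P z‖ ≤ ‖z - u‖) (a b : H) :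
    ‖P a - P b‖ ^ 2 ≤ ⟪a - b, P a - P b⟫ := by
  have h1 := proj_var hK (hP a).1 (hP a).2 (hP b).1
  have h2 := proj_var hK (hP b).1 (hP b).2 (hP a).1
  rw [← real_inner_self_eq_norm_sq]
  simp only [inner_sub_left, inner_sub_right] at *
  linarith

lemma proj_nonexp {H : Type*} [NormedAddCommGroup H] [InnerProductSpace ℝ H]
    {K : Set H} (hK : Convex ℝ K) (P : H → H)
    (hP : ∀ z, P z ∈ K ∧ ∀ u ∈ K, ‖z - P z‖ ≤ ‖z - u‖) (a b : H) :
    ‖P a - P b‖ ≤ ‖a - b‖ := by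
  have h := proj_firm hK P hP a b
  have h2 := real_inner_le_norm (a - b) (P a - P b)
  by_contra! hc
  nlinarith [norm_nonneg (a - b), norm_nonneg (P a - P b)]

lemma proj_refl_nonexp {H : Type*} [NormedAddCommGroup H] [InnerProductSpace ℝ H]
    {K : Set H} (hK : Convex ℝ K) (P : H → H)
    (hP : ∀ z, P z ∈ K ∧ ∀ u ∈ K, ‖z - P z‖ ≤ ‖z - u‖) (a b : H) :
    ‖(2 : ℝ) • (P a - P b) - (a - b)‖ ≤ ‖a - b‖ := by
  have h := proj_firm hK P hP a b
  refine le_of_sq_le_sq_aux ?_ (norm_nonneg _)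
  rw [norm_sub_sq_real, norm_smul, real_inner_smul_left, real_inner_comm]
  norm_num
  nlinarith

lemma refl_resolvent_lip {H : Type*} [NormedAddCommGroup H] [InnerProductSpace ℝ H]
    (T : H → H) (μ L : ℝ) (hμ : 0 < μ)
    (hmono : ∀ x y : H, μ * ‖x - y‖ ^ 2 ≤ ⟪T x - T y, x - y⟫)
    (hLip : ∀ x y : H, ‖T x - T y‖ ≤ L * ‖x - y‖)
    (hγ₁ : 1 ≤ L / μ)
    (J : H → H) (hJ : ∀ u : H, J u + (1 / L) • T (J u) = u) (u v : H) :
    ‖((2 : ℝ) • J u - u) - ((2 : ℝ) • J v - v)‖ ≤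
      Real.sqrt ((L / μ - 1) / (L / μ + 1)) * ‖u - v‖ := by
  have hL : 0 < L := by
    have := (le_div_iff₀ hμ).1 hγ₁
    linarith
  set d := J u - J v with hd
  set t := (1 / L) • (T (J u) - T (J v)) with ht
  have e1 : u - v = d + t := by
    conv_lhs => rw [← hJ u, ← hJ v]
    rw [hd, ht, smul_sub]; abel
  have e2 : ((2 : ℝ) • J u - u) - ((2 : ℝ) • J v - v) = d - t := by
    have : ((2 : ℝ) • J u - u) - ((2 : ℝ) • J v - v) = (2 : ℝ) • d - (u - v) := by
      rw [hd, smul_sub]; abel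
    rw [this, e1, two_smul]; abel
  have ht1 : ‖t‖ ≤ ‖d‖ := by
    rw [ht, norm_smul, Real.norm_of_nonneg (by positivity), one_div, inv_mul_le_iff₀ hL]
    exact hLip _ _
  have ht2 : ‖d‖ ^ 2 ≤ (L / μ) * ⟪d, t⟫ := by
    rw [ht, real_inner_smul_right, real_inner_comm]
    have h := hmono (J u) (J v)
    rw [← hd] at h
    have : L / μ * (1 / L * ⟪T (J u) - T (J v), d⟫) = ⟪T (J u) - T (J v), d⟫ / μ := by
      field_simp
    rw [this, le_div_iff₀ hμ]; linarith
  rw [e1, e2]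
  generalize L / μ = g at *
  have hq : 0 ≤ (g - 1) / (g + 1) := div_nonneg (by linarith) (by linarith)
  refine le_of_sq_le_sq_aux ?_ (by positivity)
  rw [mul_pow, Real.sq_sqrt hq, norm_sub_sq_real, norm_add_sq_real, div_mul_eq_mul_div,
    le_div_iff₀ (by linarith)]
  nlinarith [norm_nonneg t, pow_le_pow_left₀ (norm_nonneg t) ht1 2]

/-- Under assumptions (A1)–(A4), with `1 ≤ γ = L/μ < 5/3`, `ξ = 1/L`,
`L_{ξT} = √((γ−1)/(γ+1))`, and parameters `α, β > 0` with `2l ≤ β ≤ α L_{ξT}` and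
`α + 2L_{ξT} < 1`, the map
`ρ(z, y, x) = (P_{Φ(x)}(y), R_{ξT}(2P_{Φ(x)}(y) − y), P_C(z))` is `δ`-contractive on
`H × H × C` for the norm `‖(z,y,x)‖₁ = α‖z‖ + ‖y‖ + β‖x‖`, with
`δ = α + 2L_{ξT} < 1`. -/
theorem douglas_rachford_map_contractive
    {H : Type*} [NormedAddCommGroup H] [InnerProductSpace ℝ H]
    (C : Set H) (hCne : C.Nonempty) (hCcl : IsClosed C) (hCcv : Convex ℝ C)
    (Φ : H → Set H)
    (hΦ : ∀ x ∈ C, (Φ x).Nonempty ∧ IsClosed (Φ x) ∧ Convex ℝ (Φ x))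
    (PC : H → H) (hPC : ∀ z : H, PC z ∈ C ∧ ∀ u ∈ C, ‖z - PC z‖ ≤ ‖z - u‖)
    (PΦ : H → H → H)
    (hPΦ : ∀ x ∈ C, ∀ z : H, PΦ x z ∈ Φ x ∧ ∀ u ∈ Φ x, ‖z - PΦ x z‖ ≤ ‖z - u‖)
    (l : ℝ) (hl : 0 < l)
    (hcontr : ∀ x ∈ C, ∀ y ∈ C, ∀ z : H, ‖PΦ x z - PΦ y z‖ ≤ l * ‖x - y‖)
    (T : H → H) (μ L : ℝ) (hμ : 0 < μ)
    (hmono : ∀ x y : H, μ * ‖x - y‖ ^ 2 ≤ ⟪T x - T y, x - y⟫)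
    (hLip : ∀ x y : H, ‖T x - T y‖ ≤ L * ‖x - y‖)
    (hγ₁ : 1 ≤ L / μ) (hγ₂ : L / μ < 5 / 3)
    (J : H → H) (hJ : ∀ u : H, J u + (1 / L) • T (J u) = u)
    (α β : ℝ) (hα : 0 < α) (hβ : 0 < β)
    (hβ₁ : 2 * l ≤ β) (hβ₂ : β ≤ α * Real.sqrt ((L / μ - 1) / (L / μ + 1)))
    (hδ : α + 2 * Real.sqrt ((L / μ - 1) / (L / μ + 1)) < 1) :
    ∀ z₁ y₁ : H, ∀ x₁ ∈ C, ∀ z₂ y₂ : H, ∀ x₂ ∈ C,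
      α * ‖PΦ x₁ y₁ - PΦ x₂ y₂‖ +
        ‖((2 : ℝ) • J ((2 : ℝ) • PΦ x₁ y₁ - y₁) - ((2 : ℝ) • PΦ x₁ y₁ - y₁)) -
          ((2 : ℝ) • J ((2 : ℝ) • PΦ x₂ y₂ - y₂) - ((2 : ℝ) • PΦ x₂ y₂ - y₂))‖ +
        β * ‖PC z₁ - PC z₂‖ ≤
      (α + 2 * Real.sqrt ((L / μ - 1) / (L / μ + 1))) *
        (α * ‖z₁ - z₂‖ + ‖y₁ - y₂‖ + β * ‖x₁ - x₂‖) := by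
  intro z₁ y₁ x₁ hx₁ z₂ y₂ x₂ hx₂
  have hR := refl_resolvent_lip T μ L hμ hmono hLip hγ₁ J hJ
    ((2 : ℝ) • PΦ x₁ y₁ - y₁) ((2 : ℝ) • PΦ x₂ y₂ - y₂)
  have hs := Real.sqrt_nonneg ((L / μ - 1) / (L / μ + 1))
  generalize Real.sqrt ((L / μ - 1) / (L / μ + 1)) = s at *
  have hC := proj_nonexp hCcv PC hPC z₁ z₂
  have hN := proj_nonexp (hΦ x₁ hx₁).2.2 (PΦ x₁) (hPΦ x₁ hx₁) y₁ y₂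
  have hF := proj_refl_nonexp (hΦ x₁ hx₁).2.2 (PΦ x₁) (hPΦ x₁ hx₁) y₁ y₂
  have hl' := hcontr x₁ hx₁ x₂ hx₂ y₂
  have a1 : ‖PΦ x₁ y₁ - PΦ x₂ y₂‖ ≤ ‖y₁ - y₂‖ + l * ‖x₁ - x₂‖ :=
    (norm_sub_le_norm_sub_add_norm_sub _ (PΦ x₁ y₂) _).trans (add_le_add hN hl')
  have a2 : ‖((2 : ℝ) • PΦ x₁ y₁ - y₁) - ((2 : ℝ) • PΦ x₂ y₂ - y₂)‖
      ≤ ‖y₁ - y₂‖ + 2 * (l * ‖x₁ - x₂‖) := by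
    have e : ((2 : ℝ) • PΦ x₁ y₁ - y₁) - ((2 : ℝ) • PΦ x₂ y₂ - y₂) =
        ((2 : ℝ) • (PΦ x₁ y₁ - PΦ x₁ y₂) - (y₁ - y₂))
          + (2 : ℝ) • (PΦ x₁ y₂ - PΦ x₂ y₂) := by
      simp only [smul_sub]; abel
    rw [e]
    refine (norm_add_le _ _).trans (add_le_add hF ?_)
    rw [norm_smul]
    norm_num
    exact hl'
  have hx := norm_nonneg (x₁ - x₂)
  have hy := norm_nonneg (y₁ - y₂)
  have hz := norm_nonneg (z₁ - z₂)
  have b1 := mul_le_mul_of_nonneg_left a1 hα.le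
  have b2 := hR.trans (mul_le_mul_of_nonneg_left a2 hs)
  have b3 := mul_le_mul hβ₂ hC (norm_nonneg _) (by positivity)
  have c1 : (α + 2 * s) * (l * ‖x₁ - x₂‖) ≤ (α + 2 * s) * (β * ‖x₁ - x₂‖) := by
    gcongr
    linarith
  have c2 : 0 ≤ s * ‖y₁ - y₂‖ := by positivity
  have c3 : 0 ≤ α * α * ‖z₁ - z₂‖ := by positivity
  have c4 : 0 ≤ s * α * ‖z₁ - z₂‖ := by positivity
  nlinarith
end

section
/- Let H be a real Hilbert space, C ⊆ H nonempty, closed, convex; Φ : C ⇉ H with Φ(x) nonempty, closed, convex for every x ∈ C and ‖P_{Φ(x)}(z) − P_{Φ(y)}(z)‖ ≤ l‖x − y‖ for all x, y ∈ C, z ∈ H; and T : H → H μ-strongly monotone and L-Lipschitz with 1 ≤ γ := L/μ < 5/3. Set ξ = 1/L, L_{ξT} = √((γ − 1)/(γ + 1)), and suppose α, β > 0 satisfy 2l ≤ β ≤ α L_{ξT} and α + 2L_{ξT} < 1. Then there exists a unique triple (z*, y*, x*) ∈ H × H × C such that z* = P_{Φ(x*)}(y*), y* = R_{ξT}(2z*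 − y*), and x* = P_C(z*); in particular, the quasi-variational inequality with non-self constraint map Φ has a unique projected solution x*. -/
open scoped RealInnerProductSpace

lemma aux_vi {H : Type*} [NormedAddCommGroup H] [InnerProductSpace ℝ H]
    {K : Set H} (hK : Convex ℝ K) {z p : H} (hp : p ∈ K)
    (h : ∀ u ∈ K, ‖z - p‖ ≤ ‖z - u‖) : ∀ u ∈ K, ⟪z - p, u - p⟫ ≤ 0 := by
  refine (norm_eq_iInf_iff_real_inner_le_zero hK hp).1 ?_
  have : Nonempty K := ⟨⟨p, hp⟩⟩
  apply le_antisymm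
  · exact le_ciInf fun w => h w w.2
  · exact ciInf_le (f := fun w : K => ‖z - w‖)
      ⟨0, by rintro _ ⟨w, rfl⟩; exact norm_nonneg _⟩ ⟨p, hp⟩

lemma aux_nonexp {H : Type*} [NormedAddCommGroup H] [InnerProductSpace ℝ H]
    {K : Set H} {z p z' p' : H} (hp : p ∈ K) (hp' : p' ∈ K)
    (h : ∀ u ∈ K, ⟪z - p, u - p⟫ ≤ 0) (h' : ∀ u ∈ K, ⟪z' - p', u - p'⟫ ≤ 0) :
    ‖p - p'‖ ≤ ‖z - z'‖ := by
  have h1 := h p' hp'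
  have h2 := h' p hp
  have h3 : ‖p - p'‖ ^ 2 ≤ ⟪z - z', p - p'⟫ := by
    rw [← real_inner_self_eq_norm_sq]
    have : ⟪z - z', p - p'⟫ - ⟪p - p', p - p'⟫
        = -⟪z - p, p' - p⟫ - ⟪z' - p', p - p'⟫ := by
      simp only [inner_sub_left, inner_sub_right]
      ring
    linarith
  have h4 := real_inner_le_norm (z - z') (p - p')
  by_contra hc
  push Not at hc
  have := norm_nonneg (z - z')
  nlinarith [this, h3, h4, hc, mul_pos (lt_of_le_of_lt this hc) (sub_pos.2 hc), this, hc]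

/-- Under assumptions (A1)–(A4), with `1 ≤ γ = L/μ < 5/3`, `ξ = 1/L`,
`L_{ξT} = √((γ−1)/(γ+1))`, and `α, β > 0` with `2l ≤ β ≤ α L_{ξT}` and `α + 2L_{ξT} < 1`,
there is a unique triple `(z*, y*, x*) ∈ H × H × C` with `z* = P_{Φ(x*)}(y*)`,
`y* = R_{ξT}(2z* − y*)`, `x* = P_C(z*)`; in particular the quasi-variational inequality
with non-self constraint map `Φ` has a unique projected solution. -/
theorem douglas_rachford_unique_projected_solution
    {H : Type*} [NormedAddCommGroup H] [InnerProductSpace ℝ H] [CompleteSpace H]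
    (C : Set H) (hCne : C.Nonempty) (hCcl : IsClosed C) (hCcv : Convex ℝ C)
    (Φ : H → Set H)
    (hΦ : ∀ x ∈ C, (Φ x).Nonempty ∧ IsClosed (Φ x) ∧ Convex ℝ (Φ x))
    (PC : H → H) (hPC : ∀ z : H, PC z ∈ C ∧ ∀ u ∈ C, ‖z - PC z‖ ≤ ‖z - u‖)
    (PΦ : H → H → H)
    (hPΦ : ∀ x ∈ C, ∀ z : H, PΦ x z ∈ Φ x ∧ ∀ u ∈ Φ x, ‖z - PΦ x z‖ ≤ ‖z - u‖)
    (l : ℝ) (hl : 0 < l)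
    (hcontr : ∀ x ∈ C, ∀ y ∈ C, ∀ z : H, ‖PΦ x z - PΦ y z‖ ≤ l * ‖x - y‖)
    (T : H → H) (μ L : ℝ) (hμ : 0 < μ)
    (hmono : ∀ x y : H, μ * ‖x - y‖ ^ 2 ≤ ⟪T x - T y, x - y⟫)
    (hLip : ∀ x y : H, ‖T x - T y‖ ≤ L * ‖x - y‖)
    (hγ₁ : 1 ≤ L / μ) (hγ₂ : L / μ < 5 / 3)
    (J : H → H) (hJ : ∀ u : H, J u + (1 / L) • T (J u) = u)
    (α β : ℝ) (hα : 0 < α) (hβ : 0 < β)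
    (hβ₁ : 2 * l ≤ β) (hβ₂ : β ≤ α * Real.sqrt ((L / μ - 1) / (L / μ + 1)))
    (hδ : α + 2 * Real.sqrt ((L / μ - 1) / (L / μ + 1)) < 1) :
    (∃! w : H × H × H, w.2.2 ∈ C ∧
        w.1 = PΦ w.2.2 w.2.1 ∧
        w.2.1 = (2 : ℝ) • J ((2 : ℝ) • w.1 - w.2.1) - ((2 : ℝ) • w.1 - w.2.1) ∧
        w.2.2 = PC w.1) ∧
    (∃! x₀ : H, x₀ ∈ C ∧ ∃ z₀ ∈ Φ x₀,
        (∀ v ∈ Φ x₀, 0 ≤ ⟪T z₀, v - z₀⟫) ∧ x₀ = PC z₀) := by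
  have hL : 0 < L := by
    have := (le_div_iff₀ hμ).1 hγ₁
    linarith
  have hμL : 3 / 5 * L ≤ μ := by
    have := (div_lt_iff₀ hμ).1 hγ₂
    linarith
  have hl16 : l ≤ 1 / 16 := by
    set q := Real.sqrt ((L / μ - 1) / (L / μ + 1))
    have hq : 0 ≤ q := Real.sqrt_nonneg _
    nlinarith [sq_nonneg (4 * q - 1)]
  have hξ : 0 < 1 / L := by positivity
  have viC : ∀ z, ∀ u ∈ C, ⟪z - PC z, u - PC z⟫ ≤ 0 := fun z =>
    aux_vi hCcv (hPC z).1 (hPC z).2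
  have viΦ : ∀ x ∈ C, ∀ z, ∀ u ∈ Φ x, ⟪z - PΦ x z, u - PΦ x z⟫ ≤ 0 := fun x hx z =>
    aux_vi (hΦ x hx).2.2 (hPΦ x hx z).1 (hPΦ x hx z).2
  have neC : ∀ z z', ‖PC z - PC z'‖ ≤ ‖z - z'‖ := fun z z' =>
    aux_nonexp (hPC z).1 (hPC z').1 (viC z) (viC z')
  have neΦ : ∀ x ∈ C, ∀ z z', ‖PΦ x z - PΦ x z'‖ ≤ ‖z - z'‖ := fun x hx z z' =>
    aux_nonexp (hPΦ x hx z).1 (hPΦ x hx z').1 (viΦ x hx z) (viΦ x hx z')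
  have fwd : ∀ z z', ‖(z - (1 / L) • T z) - (z' - (1 / L) • T z')‖ ≤ 9 / 10 * ‖z - z'‖ := by
    intro z z'
    have e : (z - (1 / L) • T z) - (z' - (1 / L) • T z')
        = (z - z') - (1 / L) • (T z - T z') := by
      rw [smul_sub]; abel
    have h1 := hmono z z'
    have h2 := hLip z z'
    have h3 : ‖(1 / L) • (T z - T z')‖ ≤ ‖z - z'‖ := by
      rw [norm_smul, Real.norm_of_nonneg hξ.le, one_div, inv_mul_le_iff₀ hL]
      exact h2
    have h4 : 3 / 5 * ‖z - z'‖ ^ 2 ≤ ⟪z - z', (1 / L) • (T z - T z')⟫ := by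
      rw [inner_smul_right, real_inner_comm, one_div, le_inv_mul_iff₀ hL]
      nlinarith [sq_nonneg ‖z - z'‖]
    rw [e]
    refine le_of_sq_le_sq ?_ (by positivity)
    rw [norm_sub_sq_real]
    have h5 : ‖(1 / L) • (T z - T z')‖ ^ 2 ≤ ‖z - z'‖ ^ 2 := by gcongr
    nlinarith [sq_nonneg ‖z - z'‖]
  let G : H → H := fun z => PΦ (PC z) (z - (1 / L) • T z)
  have hG : ContractingWith (97 / 100 : NNReal) G := by
    refine ⟨by rw [← NNReal.coe_lt_coe]; norm_num, LipschitzWith.of_dist_le_mul ?_⟩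
    intro z z'
    rw [dist_eq_norm, dist_eq_norm]
    have h1 := hcontr _ (hPC z).1 _ (hPC z').1 (z - (1 / L) • T z)
    have h2 := neΦ _ (hPC z').1 (z - (1 / L) • T z) (z' - (1 / L) • T z')
    have h3 := norm_sub_le_norm_sub_add_norm_sub (PΦ (PC z) (z - (1 / L) • T z))
      (PΦ (PC z') (z - (1 / L) • T z)) (PΦ (PC z') (z' - (1 / L) • T z'))
    have h4 := fwd z z'
    have h5 := neC z z'
    have h6 : l * ‖PC z - PC z'‖ ≤ 1 / 16 * ‖z - z'‖ := by gcongr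
    have h7 := norm_nonneg (z - z')
    change ‖PΦ (PC z) (z - (1 / L) • T z) - PΦ (PC z') (z' - (1 / L) • T z')‖ ≤ _
    push_cast
    linarith
  obtain ⟨z, hz⟩ : ∃ z, G z = z := ⟨_, hG.fixedPoint_isFixedPt⟩
  have huniq : ∀ w, G w = w → w = z := fun w hw => hG.fixedPoint_unique' hw hz
  have hJz : ∀ w, J (w + (1 / L) • T w) = w := by
    intro w
    set p := J (w + (1 / L) • T w) with hp
    have h1 : p + (1 / L) • T p = w + (1 / L) • T w := hJ _
    have h2 : p - w = -((1 / L) • (T p - T w)) := by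
      rw [smul_sub, neg_sub, sub_eq_sub_iff_add_eq_add, h1, add_comm]
    have h3 : ‖p - w‖ ^ 2 = -((1 / L) * ⟪T p - T w, p - w⟫) := by
      rw [← real_inner_self_eq_norm_sq]
      nth_rewrite 1 [h2]
      rw [inner_neg_left, real_inner_smul_left]
    have h4 := hmono p w
    have h5 : 0 ≤ ⟪T p - T w, p - w⟫ := le_trans (by positivity) h4
    have h6 : ‖p - w‖ ^ 2 ≤ 0 := by
      rw [h3]; have := mul_nonneg hξ.le h5; linarith
    have h7 : ‖p - w‖ = 0 := by
      have := sq_nonneg ‖p - w‖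
      exact pow_eq_zero_iff (two_ne_zero) |>.1 (le_antisymm h6 this)
    exact sub_eq_zero.1 (norm_eq_zero.1 h7)
  constructor
  · refine ⟨(z, z - (1 / L) • T z, PC z), ⟨(hPC z).1, hz.symm, ?_, rfl⟩, ?_⟩
    · change z - (1 / L) • T z = (2 : ℝ) • J ((2 : ℝ) • z - (z - (1 / L) • T z))
        - ((2 : ℝ) • z - (z - (1 / L) • T z))
      have e : (2 : ℝ) • z - (z - (1 / L) • T z) = z + (1 / L) • T z := by
        rw [two_smul]; abel
      rw [e, hJz, two_smul]; abel
    · rintro ⟨a, b, c⟩ ⟨hc, ha, hb, hca⟩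
      dsimp only at hc ha hb hca
      have h1 : J ((2 : ℝ) • a - b) = a := by
        have h2 : (2 : ℝ) • J ((2 : ℝ) • a - b) = (2 : ℝ) • a := by
          have := eq_sub_iff_add_eq.1 hb
          rw [← this]; abel
        exact smul_right_injective H (two_ne_zero) h2
      have h2 := hJ ((2 : ℝ) • a - b)
      rw [h1, two_smul] at h2
      have h3 : b = a - (1 / L) • T a := by
        have : b = a + a - (a + (1 / L) • T a) := by rw [h2]; abel
        rw [this]; abel
      have h4 : a = z := by
        apply huniq
        change PΦ (PC a) (a - (1 / L) • T a) = a
        rw [← h3, ← hca, ← ha]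
      subst h4
      rw [h3, hca]
  · have hzmem : z ∈ Φ (PC z) := by
      have := (hPΦ _ (hPC z).1 (z - (1 / L) • T z)).1
      rwa [show PΦ (PC z) (z - (1 / L) • T z) = z from hz] at this
    refine ⟨PC z, ⟨(hPC z).1, z, hzmem, ?_, rfl⟩, ?_⟩
    · intro v hv
      have := viΦ _ (hPC z).1 (z - (1 / L) • T z) v hv
      rw [show PΦ (PC z) (z - (1 / L) • T z) = z from hz, sub_sub_cancel_left,
        inner_neg_left, real_inner_smul_left] at this
      exact nonneg_of_mul_nonneg_right (by linarith) hξ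
    · rintro x ⟨hx, w, hw, hvi, hxw⟩
      have h4 : w = z := by
        apply huniq
        change PΦ (PC w) (w - (1 / L) • T w) = w
        rw [← hxw]
        have hvw : ∀ u ∈ Φ x, ⟪(w - (1 / L) • T w) - w, u - w⟫ ≤ 0 := by
          intro u hu
          rw [sub_sub_cancel_left, inner_neg_left, real_inner_smul_left]
          have := mul_nonneg hξ.le (hvi u hu)
          linarith
        have := aux_nonexp (hPΦ x hx (w - (1 / L) • T w)).1 hw (viΦ x hx _) hvw
        rw [sub_self, norm_zero] at this
        exact sub_eq_zero.1 (norm_le_zero_iff.1 this)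
      rw [hxw, h4]
end

section
/- Let H be a real Hilbert space, C ⊆ H nonempty, closed, convex; Φ : C ⇉ H with Φ(x) nonempty, closed, convex for every x ∈ C and ‖P_{Φ(x)}(z) − P_{Φ(y)}(z)‖ ≤ l‖x − y‖ for all x, y ∈ C, z ∈ H; and T : H → H μ-strongly monotone and L-Lipschitz with 1 ≤ γ := L/μ < 5/3. Set ξ = 1/L and suppose α, β > 0 satisfy 2l ≤ β ≤ α√((γ−1)/(γ+1)) and α < 1 − 2√((γ − 1)/(γ + 1)). Let (z*, y*, x*) be the unique triple with z* = P_{Φ(x*)}(y*), y* = R_{ξT}(2z* − y*), x* = P_C(z*). Given x₀ ∈ C, y₀ ∈ H, define the Douglas–Rachford iterates z_{k+1} = P_{Φ(x_k)}(y_k), y_{k+1} = R_{ξT}(2z_{k+1} − y_k), x_{k+1} = P_C(z_{k+1}). Then with δ := α + 2√((γ − 1)/(γ + 1)) < 1, for every k ≥ 0: α‖z_{k+1} − z*‖ + ‖y_k − y*‖ + β‖x_k − x*‖ ≤ δ^k (α‖z₁ − z*‖ + ‖y₀ − y*‖ + β‖x₀ − x*‖); in particular (z_k), (y_k), (x_k)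 converge strongly to z*, y*, x* respectively. -/
open scoped RealInnerProductSpace

section helpers
variable {H : Type*} [NormedAddCommGroup H] [InnerProductSpace ℝ H]

lemma proj_char {K : Set H} (hK : Convex ℝ K) {z p : H} (hp : p ∈ K)
    (h : ∀ u ∈ K, ‖z - p‖ ≤ ‖z - u‖) : ∀ u ∈ K, ⟪z - p, u - p⟫ ≤ 0 := by
  refine (norm_eq_iInf_iff_real_inner_le_zero hK hp).1 ?_
  have : Nonempty K := ⟨⟨p, hp⟩⟩
  apply le_antisymm
  · exact le_ciInf fun w => h w w.2
  · exact ciInf_le ⟨0, by rintro _ ⟨w, rfl⟩; exact norm_nonneg _⟩ (⟨p, hp⟩ : K)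

lemma proj_firm_s14 {K : Set H} (hK : Convex ℝ K) {u v p q : H} (hp : p ∈ K) (hq : q ∈ K)
    (h : ∀ w ∈ K, ‖u - p‖ ≤ ‖u - w‖) (hnew : ∀ w ∈ K, ‖v - q‖ ≤ ‖v - w‖) :
    ‖p - q‖ ^ 2 ≤ ⟪p - q, u - v⟫ := by
  have h1 := proj_char hK hp h q hq
  have h2 := proj_char hK hq hnew p hp
  have e : ⟪p - q, u - v⟫ = ‖p - q‖ ^ 2 - ⟪u - p, q - p⟫ - ⟪v - q, p - q⟫ := by
    rw [← real_inner_self_eq_norm_sq, real_inner_comm (q - p), real_inner_comm (p - q) (v - q)]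
    have : u - v = (p - q) + (u - p) - (v - q) := by abel
    rw [this, inner_sub_right, inner_add_right]
    have : q - p = -(p - q) := by abel
    rw [this, inner_neg_left]
    ring
  linarith

lemma refl_le {d w : H} (h : ‖d‖ ^ 2 ≤ ⟪d, w⟫) : ‖(2 : ℝ) • d - w‖ ≤ ‖w‖ := by
  refine (sq_le_sq₀ (norm_nonneg _) (norm_nonneg _)).1 ?_
  rw [norm_sub_sq_real, norm_smul, inner_smul_left]
  simp
  nlinarith

lemma firm_le {d w : H} (h : ‖d‖ ^ 2 ≤ ⟪d, w⟫) : ‖d‖ ≤ ‖w‖ := by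
  have := real_inner_le_norm d w
  by_contra! hc
  nlinarith [norm_nonneg w, norm_nonneg d]

lemma resolvent_contr {d e : H} {g : ℝ} (hg : 1 ≤ g) (h1 : ‖e‖ ≤ ‖d‖)
    (h2 : ‖d‖ ^ 2 ≤ g * ⟪d, e⟫) :
    ‖d - e‖ ≤ Real.sqrt ((g - 1) / (g + 1)) * ‖d + e‖ := by
  have hs : 0 ≤ (g - 1) / (g + 1) := div_nonneg (by linarith) (by linarith)
  refine (sq_le_sq₀ (norm_nonneg _) (by positivity)).1 ?_
  rw [mul_pow, Real.sq_sqrt hs, norm_sub_sq_real, norm_add_sq_real, div_mul_eq_mul_div,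
    le_div_iff₀ (by linarith)]
  have : ‖e‖ ^ 2 ≤ ‖d‖ ^ 2 := by gcongr
  nlinarith

end helpers

/-- Convergence of the Douglas–Rachford splitting algorithm: Under
assumptions (A1)–(A4), with `1 ≤ γ = L/μ < 5/3`, `ξ = 1/L`, and `α, β > 0` satisfying
`2l ≤ β ≤ α√((γ−1)/(γ+1))` and `α < 1 − 2√((γ−1)/(γ+1))`, let `(z*, y*, x*)` be the
fixed-point triple and let `(z_k), (y_k), (x_k)` be the iterates
`z_{k+1} = P_{Φ(x_k)}(y_k)`, `y_{k+1} = R_{ξT}(2z_{k+1} − y_k)`, `x_{k+1} = P_C(z_{k+1})`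
started from `x₀ ∈ C`, `y₀ ∈ H`. Then with `δ = α + 2√((γ−1)/(γ+1)) < 1`, for all `k`,
`α‖z_{k+1} − z*‖ + ‖y_k − y*‖ + β‖x_k − x*‖ ≤ δ^k (α‖z₁ − z*‖ + ‖y₀ − y*‖ + β‖x₀ − x*‖)`,
and the sequences converge strongly to `z*`, `y*`, `x*`. -/
theorem douglas_rachford_convergence
    {H : Type*} [NormedAddCommGroup H] [InnerProductSpace ℝ H] [CompleteSpace H]
    (C : Set H) (hCne : C.Nonempty) (hCcl : IsClosed C) (hCcv : Convex ℝ C)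
    (Φ : H → Set H)
    (hΦ : ∀ x ∈ C, (Φ x).Nonempty ∧ IsClosed (Φ x) ∧ Convex ℝ (Φ x))
    (PC : H → H) (hPC : ∀ z : H, PC z ∈ C ∧ ∀ u ∈ C, ‖z - PC z‖ ≤ ‖z - u‖)
    (PΦ : H → H → H)
    (hPΦ : ∀ x ∈ C, ∀ z : H, PΦ x z ∈ Φ x ∧ ∀ u ∈ Φ x, ‖z - PΦ x z‖ ≤ ‖z - u‖)
    (l : ℝ) (hl : 0 < l)
    (hcontr : ∀ x ∈ C, ∀ y ∈ C, ∀ z : H, ‖PΦ x z - PΦ y z‖ ≤ l * ‖x - y‖)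
    (T : H → H) (μ L : ℝ) (hμ : 0 < μ)
    (hmono : ∀ x y : H, μ * ‖x - y‖ ^ 2 ≤ ⟪T x - T y, x - y⟫)
    (hLip : ∀ x y : H, ‖T x - T y‖ ≤ L * ‖x - y‖)
    (hγ₁ : 1 ≤ L / μ) (hγ₂ : L / μ < 5 / 3)
    (J : H → H) (hJ : ∀ u : H, J u + (1 / L) • T (J u) = u)
    (α β : ℝ) (hα : 0 < α) (hβ : 0 < β)
    (hβ₁ : 2 * l ≤ β) (hβ₂ : β ≤ α * Real.sqrt ((L / μ - 1) / (L / μ + 1)))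
    (hα₁ : α < 1 - 2 * Real.sqrt ((L / μ - 1) / (L / μ + 1)))
    -- the fixed-point triple `(z*, y*, x*)`
    (zs ys xs : H) (hxs : xs ∈ C)
    (hzs : zs = PΦ xs ys)
    (hys : ys = (2 : ℝ) • J ((2 : ℝ) • zs - ys) - ((2 : ℝ) • zs - ys))
    (hxsp : xs = PC zs)
    -- the Douglas–Rachford iterates
    (z y x : ℕ → H) (hx0 : x 0 ∈ C)
    (hzk : ∀ k : ℕ, z (k + 1) = PΦ (x k) (y k))
    (hyk : ∀ k : ℕ, y (k + 1) =
      (2 : ℝ) • J ((2 : ℝ) • z (k + 1) - y k) - ((2 : ℝ) • z (k + 1) - y k))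
    (hxk : ∀ k : ℕ, x (k + 1) = PC (z (k + 1))) :
    (∀ k : ℕ,
      α * ‖z (k + 1) - zs‖ + ‖y k - ys‖ + β * ‖x k - xs‖ ≤
        (α + 2 * Real.sqrt ((L / μ - 1) / (L / μ + 1))) ^ k *
          (α * ‖z 1 - zs‖ + ‖y 0 - ys‖ + β * ‖x 0 - xs‖)) ∧
    Filter.Tendsto z Filter.atTop (nhds zs) ∧
    Filter.Tendsto y Filter.atTop (nhds ys) ∧
    Filter.Tendsto x Filter.atTop (nhds xs) := by
  set g := L / μ with hg
  set s := Real.sqrt ((g - 1) / (g + 1)) with hs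
  have hs0 : 0 ≤ s := Real.sqrt_nonneg _
  have hL : 0 < L := by
    have : L = g * μ := by rw [hg]; field_simp
    rw [this]; exact mul_pos (by linarith) hμ
  have hR : ∀ u v : H, ‖((2 : ℝ) • J u - u) - ((2 : ℝ) • J v - v)‖ ≤ s * ‖u - v‖ := by
    intro u v
    have hu := hJ u
    have hv := hJ v
    have key := resolvent_contr (d := J u - J v) (e := (1 / L) • (T (J u) - T (J v))) hγ₁ ?_ ?_
    · have e1 : ((2 : ℝ) • J u - u) - ((2 : ℝ) • J v - v)
          = (J u - J v) - (1 / L) • (T (J u) - T (J v)) := by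
        linear_combination (norm := module) (1 : ℝ) • hu - (1 : ℝ) • hv
      have e2 : u - v = (J u - J v) + (1 / L) • (T (J u) - T (J v)) := by
        linear_combination (norm := module) (1 : ℝ) • hv - (1 : ℝ) • hu
      rw [e1, e2]
      exact key
    · rw [norm_smul, Real.norm_of_nonneg (by positivity), one_div, inv_mul_le_iff₀ hL]
      exact hLip _ _
    · rw [inner_smul_right, real_inner_comm]
      have := hmono (J u) (J v)
      have e : g * (1 / L * ⟪T (J u) - T (J v), J u - J v⟫)
          = ⟪T (J u) - T (J v), J u - J v⟫ / μ := by
        rw [hg]; field_simp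
      rw [e, le_div_iff₀ hμ]
      linarith
  have hxC : ∀ k, x k ∈ C := by
    intro k
    cases k with
    | zero => exact hx0
    | succ n => rw [hxk]; exact (hPC _).1
  -- reflected projection step
  have hfirm : ∀ k, ‖PΦ xs (y k) - PΦ xs ys‖ ^ 2 ≤ ⟪PΦ xs (y k) - PΦ xs ys, y k - ys⟫ := fun k =>
    proj_firm_s14 (hΦ xs hxs).2.2 (hPΦ xs hxs _).1 (hPΦ xs hxs _).1 (hPΦ xs hxs _).2 (hPΦ xs hxs _).2
  have hd : ∀ k, ‖z (k + 1) - PΦ xs (y k)‖ ≤ l * ‖x k - xs‖ := by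
    intro k
    rw [hzk]
    exact hcontr _ (hxC k) _ hxs _
  have ha : ∀ k, ‖z (k + 1) - zs‖ ≤ ‖y k - ys‖ + l * ‖x k - xs‖ := by
    intro k
    have h1 := firm_le (hfirm k)
    have h2 := norm_sub_le_norm_sub_add_norm_sub (z (k + 1)) (PΦ xs (y k)) zs
    rw [hzs] at h2 ⊢
    linarith [hd k]
  have hb : ∀ k, ‖y (k + 1) - ys‖ ≤ s * (‖y k - ys‖ + 2 * (l * ‖x k - xs‖)) := by
    intro k
    have h1 := refl_le (hfirm k)
    have h3 := hR ((2 : ℝ) • z (k + 1) - y k) ((2 : ℝ) • zs - ys)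
    rw [← hyk, ← hys] at h3
    refine h3.trans (mul_le_mul_of_nonneg_left ?_ hs0)
    have e : (2 : ℝ) • z (k + 1) - y k - ((2 : ℝ) • zs - ys)
        = ((2 : ℝ) • (PΦ xs (y k) - PΦ xs ys) - (y k - ys))
          + (2 : ℝ) • (z (k + 1) - PΦ xs (y k)) := by
      rw [← hzs]; module
    rw [e]
    refine (norm_add_le _ _).trans ?_
    rw [norm_smul (2 : ℝ) (z (k + 1) - PΦ xs (y k)), Real.norm_of_nonneg (by norm_num)]
    linarith [hd k]
  have hc : ∀ k, ‖x (k + 1) - xs‖ ≤ ‖z (k + 1) - zs‖ := by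
    intro k
    rw [hxk, hxsp]
    exact firm_le (proj_firm_s14 hCcv (hPC _).1 (hPC _).1 (hPC _).2 (hPC _).2)
  set V : ℕ → ℝ := fun k => α * ‖z (k + 1) - zs‖ + ‖y k - ys‖ + β * ‖x k - xs‖ with hV
  have hδ0 : 0 ≤ α + 2 * s := by positivity
  have hstep : ∀ k, V (k + 1) ≤ (α + 2 * s) * V k := by
    intro k
    simp only [hV]
    have a1 := ha (k + 1)
    have b1 := hb k
    have c1 := hc k
    have a0 := norm_nonneg (z (k + 1) - zs)
    have b0 := norm_nonneg (y k - ys)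
    have c0 := norm_nonneg (x k - xs)
    generalize ‖z (k + 1 + 1) - zs‖ = anew at *
    generalize ‖y (k + 1) - ys‖ = bnew at *
    generalize ‖x (k + 1) - xs‖ = cnew at *
    generalize ‖z (k + 1) - zs‖ = a at *
    generalize ‖y k - ys‖ = b at *
    generalize ‖x k - xs‖ = c at *
    have i1 : α * anew + bnew + β * cnew ≤ (1 + α) * bnew + (α * l + β) * cnew := by
      nlinarith [mul_le_mul_of_nonneg_left a1 hα.le]
    have i2 : (1 + α) * bnew ≤ (1 + α) * (s * (b + 2 * (l * c))) := by gcongr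
    have i3 : (α * l + β) * cnew ≤ (α * l + β) * a := by gcongr
    have i4 : (1 + α) * s ≤ α + 2 * s := by nlinarith
    have i5 : (1 + α) * s * b ≤ (α + 2 * s) * b := by gcongr
    have i6 : (1 + α) * s * ((2 * l) * c) ≤ (α + 2 * s) * (β * c) := by gcongr
    have i7 : α * l + β ≤ (α + 2 * s) * α := by
      have : α * l ≤ α * (α * s / 2) := by gcongr; linarith
      nlinarith [mul_pos hα hα, mul_nonneg hα.le hs0,
        mul_le_mul_of_nonneg_left (show s ≤ 1 by linarith) (mul_pos hα hα).le]
    have i8 : (α * l + β) * a ≤ (α + 2 * s) * α * a := by gcongr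
    nlinarith
  have hmain : ∀ k, V k ≤ (α + 2 * s) ^ k * V 0 := by
    intro k
    induction k with
    | zero => simp
    | succ n ih =>
      calc V (n + 1) ≤ (α + 2 * s) * V n := hstep n
        _ ≤ (α + 2 * s) * ((α + 2 * s) ^ n * V 0) := by gcongr
        _ = (α + 2 * s) ^ (n + 1) * V 0 := by ring
  have hV0 : Filter.Tendsto V Filter.atTop (nhds 0) := by
    have h1 := (tendsto_pow_atTop_nhds_zero_of_lt_one hδ0
      (by linarith : α + 2 * s < 1)).mul_const (V 0)
    rw [zero_mul] at h1
    exact squeeze_zero (fun k => by positivity) hmain h1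
  refine ⟨hmain, ?_, ?_, ?_⟩
  · rw [← Filter.tendsto_add_atTop_iff_nat 1, tendsto_iff_norm_sub_tendsto_zero]
    have h1 := hV0.const_mul α⁻¹
    rw [mul_zero] at h1
    refine squeeze_zero (fun k => norm_nonneg _) (fun k => ?_) h1
    rw [le_inv_mul_iff₀ hα]
    simp only [hV]
    nlinarith [norm_nonneg (y k - ys), mul_nonneg hβ.le (norm_nonneg (x k - xs))]
  · rw [tendsto_iff_norm_sub_tendsto_zero]
    refine squeeze_zero (fun k => norm_nonneg _) (fun k => ?_) hV0
    simp only [hV]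
    nlinarith [mul_nonneg hα.le (norm_nonneg (z (k + 1) - zs)),
      mul_nonneg hβ.le (norm_nonneg (x k - xs))]
  · rw [tendsto_iff_norm_sub_tendsto_zero]
    have h1 := hV0.const_mul β⁻¹
    rw [mul_zero] at h1
    refine squeeze_zero (fun k => norm_nonneg _) (fun k => ?_) h1
    rw [le_inv_mul_iff₀ hβ]
    simp only [hV]
    nlinarith [norm_nonneg (y k - ys), mul_nonneg hα.le (norm_nonneg (z (k + 1) - zs))]
end
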